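/- Let {H_iα_i}_{i=1}^s be a coset partition of F_n (n ≥ 2) with indices d_i > 1 and Schreier-graph periods h_i. Suppose exactly one value h > 1 occurs among the periods, with r := |{i : h_i = h}| repetitions. Then r ≥ h; moreover if r = h then all the indices d_i with h_i = h are equal (so the partition has multiplicity when r = h ≥ 2). -/

import Mathlib

open Finset in
/-- If a finite group `G` is partitioned into right cosets `K i * β i`, and `ψ : G →* C` is a
surjection which kills `K i` for `i ∈ P` and is surjective on `K i` for `i ∉ P`, then the cosets
indexed by `P` carry the same total mass over each element of `C`. -/
theorem sum_card_fiber_eq_of_coset_partition {ι G C : Type*} [Fintype ι] [DecidableEq ι] [Group G]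
    [Finite G] [Group C] [DecidableEq C] (K : ι → Subgroup G) (β : ι → G)
    (hpart : ∀ g : G, ∃! i, g * (β i)⁻¹ ∈ K i) (ψ : G →* C) (hψ : Function.Surjective ψ)
    (P : Finset ι) (hker : ∀ i ∈ P, K i ≤ ψ.ker)
    (hsurj : ∀ i ∉ P, ∀ z : C, ∃ u ∈ K i, ψ u = z) (k k' : C) :
    ∑ i ∈ P with ψ (β i) = k, Nat.card (K i) = ∑ i ∈ P with ψ (β i) = k', Nat.card (K i) := by
  classical
  have := Fintype.ofFinite G
  let f : ι → C → ℕ := fun i z => #{x : G | x * (β i)⁻¹ ∈ K i ∧ ψ x = z}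
  have total (z : C) : ∑ i, f i z = #{x : G | ψ x = z} := by
    rw [← card_biUnion]
    · congr 1
      ext x
      simp only [mem_biUnion, mem_univ, true_and, mem_filter]
      exact ⟨fun ⟨_, h⟩ => h.2, fun h => ⟨_, (hpart x).choose_spec.1, h⟩⟩
    · intro i _ j _ hij
      refine Finset.disjoint_left.2 fun x hx hy => hij ?_
      exact (hpart x).unique (mem_filter.1 hx).2.1 (mem_filter.1 hy).2.1
  have transl (i : ι) (u : G) (hu : u ∈ K i) (z : C) : f i (ψ u * z) = f i z := by
    refine (card_bij (fun x _ => u * x) ?_ ?_ ?_).symm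
    · intro x hx
      simp only [mem_filter, mem_univ, true_and] at hx ⊢
      exact ⟨by rw [mul_assoc]; exact mul_mem hu hx.1, by rw [map_mul, hx.2]⟩
    · intro x _ y _ hxy
      exact mul_left_cancel hxy
    · intro x hx
      simp only [mem_filter, mem_univ, true_and] at hx
      refine ⟨u⁻¹ * x, ?_, by simp⟩
      simp only [mem_filter, mem_univ, true_and]
      exact ⟨by rw [mul_assoc]; exact mul_mem (inv_mem hu) hx.1, by simp [hx.2]⟩
  have fiber (z z' : C) : #{x : G | ψ x = z} = #{x : G | ψ x = z'} := by
    obtain ⟨u, hu⟩ := hψ (z' * z⁻¹)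
    refine card_equiv (Equiv.mulLeft u) fun x => ?_
    simp [hu, mul_assoc, inv_mul_eq_one, @eq_comm _ z]
  have mass (i : ι) (hi : i ∈ P) (z : C) :
      f i z = if ψ (β i) = z then Nat.card (K i) else 0 := by
    have key (x : G) (hx : x * (β i)⁻¹ ∈ K i) : ψ x = ψ (β i) := by
      have := MonoidHom.mem_ker.1 (hker i hi hx)
      rwa [map_mul, map_inv, mul_inv_eq_one] at this
    split_ifs with hz
    · rw [Nat.card_eq_fintype_card, Fintype.card_subtype]
      refine card_equiv (Equiv.mulRight (β i)⁻¹) fun x => ?_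
      simp only [mem_filter, mem_univ, true_and, Equiv.coe_mulRight]
      exact ⟨fun h => h.1, fun h => ⟨h, (key x h).trans hz⟩⟩
    · refine card_eq_zero.2 (filter_eq_empty_iff.2 fun x _ hx => hz ?_)
      rw [← key x hx.1, hx.2]
  have outside : ∑ i ∈ Pᶜ, f i k = ∑ i ∈ Pᶜ, f i k' := by
    refine sum_congr rfl fun i hi => ?_
    obtain ⟨u, hu, hz⟩ := hsurj i (mem_compl.1 hi) (k * k'⁻¹)
    simpa [hz] using transl i u hu k'
  have h1 := sum_add_sum_compl P fun i => f i k
  have h2 := sum_add_sum_compl P fun i => f i k'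
  have h3 : ∑ i ∈ P, f i k = ∑ i ∈ P, f i k' := by
    have := (total k).trans ((fiber k k').trans (total k').symm)
    omega
  rwa [sum_congr rfl fun i hi => mass i hi k, sum_congr rfl fun i hi => mass i hi k',
    ← sum_filter, ← sum_filter] at h3

/-- In the situation of `sum_card_fiber_eq_of_coset_partition`, `P` has at least `Nat.card C`
elements, and if it has exactly that many then the `K i` with `i ∈ P` have the same index. -/
theorem card_le_and_index_eq_of_finite_coset_partition {ι G C : Type*} [Fintype ι] [Group G]
    [Finite G] [Group C] (K : ι → Subgroup G) (β : ι → G)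
    (hpart : ∀ g : G, ∃! i, g * (β i)⁻¹ ∈ K i) (ψ : G →* C) (hψ : Function.Surjective ψ)
    (P : Finset ι) (hP : P.Nonempty) (hker : ∀ i ∈ P, K i ≤ ψ.ker)
    (hsurj : ∀ i ∉ P, ∀ z : C, ∃ u ∈ K i, ψ u = z) :
    Nat.card C ≤ P.card ∧ (P.card = Nat.card C → ∀ i ∈ P, ∀ j ∈ P, (K i).index = (K j).index) := by
  classical
  have : Finite C := Finite.of_surjective ψ hψ
  have sums := sum_card_fiber_eq_of_coset_partition K β hpart ψ hψ P hker hsurj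
  have hits : Function.Surjective fun i : P => ψ (β i) := by
    intro z
    obtain ⟨i, hi⟩ := hP
    have h1 : 0 < ∑ j ∈ P with ψ (β j) = ψ (β i), Nat.card (K j) :=
      Finset.sum_pos (fun _ _ => Nat.card_pos) ⟨i, Finset.mem_filter.2 ⟨hi, rfl⟩⟩
    rw [sums _ z] at h1
    obtain ⟨j, hj⟩ := Finset.nonempty_of_sum_ne_zero h1.ne'
    exact ⟨⟨j, (Finset.mem_filter.1 hj).1⟩, (Finset.mem_filter.1 hj).2⟩
  refine ⟨by simpa using Nat.card_le_card_of_surjective _ hits, fun hcard i hi j hj => ?_⟩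
  have inj : Function.Injective fun i : P => ψ (β i) :=
    ((Nat.bijective_iff_surjective_and_card _).2 ⟨hits, by simpa using hcard⟩).1
  have single (i : ι) (hi : i ∈ P) : P.filter (fun j => ψ (β j) = ψ (β i)) = {i} := by
    ext j
    simp only [Finset.mem_filter, Finset.mem_singleton]
    exact ⟨fun h => congrArg Subtype.val (@inj ⟨j, h.1⟩ ⟨i, hi⟩ h.2), by rintro rfl; exact ⟨hi, rfl⟩⟩
  have heq : Nat.card (K i) = Nat.card (K j) := by
    simpa [single i hi, single j hj] using sums (ψ (β i)) (ψ (β j))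
  have hmul := (K i).card_mul_index.trans (K j).card_mul_index.symm
  rw [heq] at hmul
  exact Nat.eq_of_mul_eq_mul_left Nat.card_pos hmul

/-- The version of `card_le_and_index_eq_of_finite_coset_partition` for finite-index subgroups
of an arbitrary group. -/
theorem card_le_and_index_eq_of_coset_partition {ι G C : Type*} [Fintype ι] [Group G]
    [Group C] [Finite C] (H : ι → Subgroup G) [∀ i, (H i).FiniteIndex] (α : ι → G)
    (hpart : ∀ g : G, ∃! i, g * (α i)⁻¹ ∈ H i) (ψ : G →* C) (hψ : Function.Surjective ψ)
    (P : Finset ι) (hP : P.Nonempty) (hker : ∀ i ∈ P, H i ≤ ψ.ker)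
    (hsurj : ∀ i ∉ P, ∀ z : C, ∃ u ∈ H i, ψ u = z) :
    Nat.card C ≤ P.card ∧ (P.card = Nat.card C → ∀ i ∈ P, ∀ j ∈ P, (H i).index = (H j).index) := by
  let N : Subgroup G := (⨅ i, (H i).normalCore) ⊓ ψ.ker
  have : (⨅ i, (H i).normalCore).Normal :=
    Subgroup.normal_iInf_normal fun i => (H i).normalCore_normal
  have : N.Normal := inferInstanceAs ((⨅ i, (H i).normalCore) ⊓ ψ.ker).Normal
  have : (⨅ i, (H i).normalCore).FiniteIndex := Subgroup.finiteIndex_iInf fun i => inferInstance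
  have : N.FiniteIndex := inferInstanceAs ((⨅ i, (H i).normalCore) ⊓ ψ.ker).FiniteIndex
  have hNH (i : ι) : N ≤ H i :=
    inf_le_left.trans ((iInf_le _ i).trans (H i).normalCore_le)
  let π := QuotientGroup.mk' N
  have hπ : Function.Surjective π := QuotientGroup.mk'_surjective N
  have mem (i : ι) (g : G) : π g ∈ (H i).map π ↔ g ∈ H i := by
    rw [← Subgroup.mem_comap, Subgroup.comap_map_eq_self]
    simpa [π] using hNH i
  have idx (i : ι) : ((H i).map π).index = (H i).index :=
    Subgroup.index_map_eq _ hπ (by simpa [π] using hNH i)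
  let χ : G ⧸ N →* C := QuotientGroup.lift N ψ fun x hx => hx.2
  have hχ (g : G) : χ (π g) = ψ g := rfl
  simp only [← idx]
  refine card_le_and_index_eq_of_finite_coset_partition (fun i => (H i).map π) (fun i => π (α i))
    ?_ χ ?_ P hP ?_ ?_
  · intro x
    obtain ⟨g, rfl⟩ := hπ x
    simp only [← map_inv, ← map_mul, mem]
    exact hpart g
  · intro z
    obtain ⟨g, rfl⟩ := hψ z
    exact ⟨π g, rfl⟩
  · rintro i hi _ ⟨g, hg, rfl⟩
    exact hker i hi hg
  · intro i hi z
    obtain ⟨u, hu, rfl⟩ := hsurj i hi z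
    exact ⟨π u, ⟨u, hu, rfl⟩, rfl⟩

/-- The total exponent of a word. -/
noncomputable def FreeGroup.totalExponent (X : Type*) : FreeGroup X →* Multiplicative ℤ :=
  FreeGroup.lift fun _ => Multiplicative.ofAdd 1

theorem FreeGroup.toAdd_totalExponent_prod_of {X : Type*} (l : List X) :
    (totalExponent X (l.map FreeGroup.of).prod).toAdd = l.length := by
  induction l with
  | nil => simp
  | cons x l ih =>
    simp only [List.map_cons, List.prod_cons, _root_.map_mul, toAdd_mul, ih, List.length_cons]
    simp [totalExponent, add_comm]

/-- Entries of powers of the transition matrix of a Schreier graph are positive exactly when there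
is a positive word of that length leading from one vertex to the other. -/
theorem pow_transitionMatrix_pos_iff {X V : Type*} [Finite X] [Fintype V] [DecidableEq V]
    (c : FreeGroup X → V)
    (hc : ∀ x y z : FreeGroup X, c x = c y → c (x * z) = c (y * z)) (A : Matrix V V ℕ)
    (hA : ∀ p q : V, A p q = Set.ncard {a : X | ∃ g, c g = p ∧ c (g * FreeGroup.of a) = q})
    (m : ℕ) (x : FreeGroup X) (q : V) :
    0 < (A ^ m) (c x) q ↔
      ∃ l : List X, l.length = m ∧ c (x * (l.map FreeGroup.of).prod) = q := by
  have step (x : FreeGroup X) (q : V) :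
      0 < A (c x) q ↔ ∃ a : X, c (x * FreeGroup.of a) = q := by
    rw [hA, Set.ncard_pos]
    constructor
    · rintro ⟨a, g, hg, rfl⟩
      exact ⟨a, (hc _ _ _ hg).symm⟩
    · rintro ⟨a, ha⟩
      exact ⟨a, x, rfl, ha⟩
  induction m generalizing x with
  | zero => simp [List.length_eq_zero_iff, Matrix.one_apply, pos_iff_ne_zero]
  | succ m ih =>
    rw [pow_succ', Matrix.mul_apply, Finset.sum_pos_iff]
    simp only [Finset.mem_univ, true_and, CanonicallyOrderedAdd.mul_pos]
    constructor
    · rintro ⟨v, h1, h2⟩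
      obtain ⟨a, rfl⟩ := (step x v).1 h1
      obtain ⟨l, hl, h⟩ := (ih _).1 h2
      exact ⟨a :: l, by simp [hl], by simpa [mul_assoc] using h⟩
    · rintro ⟨_ | ⟨a, l⟩, hl, h⟩
      · simp at hl
      · refine ⟨c (x * FreeGroup.of a), (step _ _).2 ⟨a, rfl⟩, (ih _).2 ⟨l, by simpa using hl, ?_⟩⟩
        simpa [mul_assoc] using h

/-- If `e` divides the length of every nonempty positive word in the finite-index subgroup `H`,
then it divides the total exponent of every element of `H`. -/
theorem FreeGroup.dvd_totalExponent_of_dvd_length {X : Type*} (H : Subgroup (FreeGroup X))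
    [H.FiniteIndex] (e : ℕ)
    (he : ∀ l : List X, 0 < l.length → (l.map FreeGroup.of).prod ∈ H → e ∣ l.length)
    (g : FreeGroup X) (hg : g ∈ H) : (e : ℤ) ∣ (totalExponent X g).toAdd := by
  have key : ∀ g : FreeGroup X, ∃ l : List X,
      g⁻¹ * (l.map FreeGroup.of).prod ∈ H.normalCore ∧
        (e : ℤ) ∣ l.length - (totalExponent X g).toAdd := by
    have hinv (x : X) : ∃ l : List X,
        (FreeGroup.of x)⁻¹⁻¹ * (l.map FreeGroup.of).prod ∈ H.normalCore ∧
          (e : ℤ) ∣ l.length - (totalExponent X (FreeGroup.of x)⁻¹).toAdd := by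
      have hpos : 0 < H.normalCore.index := Nat.pos_of_ne_zero Subgroup.FiniteIndex.index_ne_zero
      have hmem : FreeGroup.of x ^ H.normalCore.index ∈ H.normalCore :=
        Subgroup.pow_index_mem _ _
      refine ⟨List.replicate (H.normalCore.index - 1) x, ?_, ?_⟩
      · rw [inv_inv, List.map_replicate, List.prod_replicate, ← pow_succ',
          Nat.sub_add_cancel hpos]
        exact hmem
      · have := he (List.replicate H.normalCore.index x) (by simpa using hpos)
          (by simpa using H.normalCore_le hmem)
        have h2 : ((e : ℤ)) ∣ (H.normalCore.index : ℤ) := by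
          exact_mod_cast (by simpa using this)
        simpa [totalExponent, Nat.cast_sub (Nat.one_le_iff_ne_zero.2 hpos.ne')] using h2
    intro g
    induction g using FreeGroup.induction_on with
    | C1 => exact ⟨[], by simp [one_mem]⟩
    | of x => exact ⟨[x], by simp [one_mem, totalExponent]⟩
    | inv_of x _ => exact hinv x
    | mul x y hx hy =>
      obtain ⟨l, h1, h2⟩ := hx
      obtain ⟨l', h1', h2'⟩ := hy
      refine ⟨l ++ l', ?_, ?_⟩
      · have hconj := H.normalCore_normal.conj_mem _ h1 ((l'.map FreeGroup.of).prod)⁻¹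
        convert mul_mem h1' hconj using 1
        simp [mul_assoc]
      · rw [List.length_append, Nat.cast_add, _root_.map_mul, toAdd_mul, add_sub_add_comm]
        exact dvd_add h2 h2'
  obtain ⟨l, h1, h2⟩ := key g
  have hl : (l.map FreeGroup.of).prod ∈ H := by
    simpa using mul_mem hg (H.normalCore_le h1)
  have h3 : e ∣ l.length := by
    rcases Nat.eq_zero_or_pos l.length with h0 | h0
    · simp [h0]
    · exact he l h0 hl
  exact (dvd_sub_right (Int.natCast_dvd_natCast.2 h3)).1 h2


/-- For a coset partition of `F_n` (`n ≥ 2`) in which exactly one period value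
`h > 1` occurs, with `r` repetitions: `r ≥ h`, and if `r = h` then all indices
`d i` with `hp i = h` coincide. -/
theorem unique_period_repetitions
    (n s : ℕ) (hn : 2 ≤ n)
    (H : Fin s → Subgroup (FreeGroup (Fin n))) (α : Fin s → FreeGroup (Fin n))
    (d : Fin s → ℕ) (hd : ∀ i, 1 < d i)
    (hpart : ∀ g : FreeGroup (Fin n), ∃! i : Fin s, g * (α i)⁻¹ ∈ H i)
    (c : (i : Fin s) → FreeGroup (Fin n) → Fin (d i))
    (hcsurj : ∀ i, Function.Surjective (c i))
    (hc : ∀ (i : Fin s) (x y : FreeGroup (Fin n)), c i x = c i y ↔ x * y⁻¹ ∈ H i)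
    (A : (i : Fin s) → Matrix (Fin (d i)) (Fin (d i)) ℕ)
    (hA : ∀ (i : Fin s) (p q : Fin (d i)), A i p q =
      Set.ncard {a : Fin n | ∃ g, c i g = p ∧ c i (g * FreeGroup.of a) = q})
    (hp : Fin s → ℕ)
    (hpdvd : ∀ (i : Fin s) (m : ℕ), 0 < m → 0 < ((A i) ^ m) (c i 1) (c i 1) → hp i ∣ m)
    (hpgcd : ∀ (i : Fin s) (e : ℕ),
      (∀ m : ℕ, 0 < m → 0 < ((A i) ^ m) (c i 1) (c i 1) → e ∣ m) → e ∣ hp i)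
    (h : ℕ) (hh : 1 < h)
    (honly : ∀ i : Fin s, 1 < hp i → hp i = h)
    (hex : ∃ i : Fin s, hp i = h)
    (r : ℕ) (hr : r = (Finset.univ.filter (fun i : Fin s => hp i = h)).card) :
    h ≤ r ∧ (r = h → ∀ i j : Fin s, hp i = h → hp j = h → d i = d j) := by
  have hcmul (i : Fin s) (x y z : FreeGroup (Fin n)) (hxy : c i x = c i y) :
      c i (x * z) = c i (y * z) := by
    rw [hc] at hxy ⊢
    simpa [mul_assoc] using hxy
  have pos_iff (i : Fin s) (m : ℕ) : 0 < ((A i) ^ m) (c i 1) (c i 1) ↔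
      ∃ l : List (Fin n), l.length = m ∧ (l.map FreeGroup.of).prod ∈ H i := by
    rw [pow_transitionMatrix_pos_iff (c i) (hcmul i) (A i) (hA i)]
    simp [hc]
  have hidx (i : Fin s) : (H i).index = d i := by
    have hrel (x y : FreeGroup (Fin n)) :
        QuotientGroup.leftRel (H i) x y ↔ c i x⁻¹ = c i y⁻¹ := by
      rw [hc, QuotientGroup.leftRel_apply, inv_inv]
    let f : FreeGroup (Fin n) ⧸ H i → Fin (d i) :=
      Quotient.lift (fun g => c i g⁻¹) fun x y => (hrel x y).1
    have hf : Function.Bijective f := by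
      constructor
      · rintro ⟨x⟩ ⟨y⟩ hxy
        exact Quotient.sound ((hrel x y).2 hxy)
      · intro v
        obtain ⟨g, rfl⟩ := hcsurj i v
        exact ⟨Quotient.mk _ g⁻¹, congrArg (c i) (inv_inv g)⟩
    rw [Subgroup.index, Nat.card_eq_of_bijective f hf, Nat.card_fin]
  have hfin (i : Fin s) : (H i).FiniteIndex := ⟨by rw [hidx]; have := hd i; omega⟩
  have hdvd (i : Fin s) (g : FreeGroup (Fin n)) (hg : g ∈ H i) :
      (hp i : ℤ) ∣ (FreeGroup.totalExponent (Fin n) g).toAdd :=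
    FreeGroup.dvd_totalExponent_of_dvd_length (H i) (hp i)
      (fun l hl hmem => hpdvd i _ hl ((pos_iff i _).2 ⟨l, rfl, hmem⟩)) g hg
  let a : Fin n := ⟨0, by omega⟩
  have hp_pos (i : Fin s) : 0 < hp i := by
    have hpos : 0 < (H i).normalCore.index :=
      Nat.pos_of_ne_zero Subgroup.FiniteIndex.index_ne_zero
    refine Nat.pos_of_dvd_of_pos (hpdvd i _ hpos ((pos_iff i _).2
      ⟨List.replicate (H i).normalCore.index a, by simp, (H i).normalCore_le ?_⟩)) hpos
    simpa using Subgroup.pow_index_mem (H i).normalCore (FreeGroup.of a)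
  have hone (i : Fin s) (hi : hp i = 1) :
      ∃ u ∈ H i, (FreeGroup.totalExponent (Fin n) u).toAdd = 1 := by
    obtain ⟨e, he⟩ := Int.subgroup_cyclic
      (((H i).map (FreeGroup.totalExponent (Fin n))).toAddSubgroup')
    rw [← AddSubgroup.zmultiples_eq_closure] at he
    have hmem (k : ℤ) : e ∣ k ↔
        ∃ u ∈ H i, (FreeGroup.totalExponent (Fin n) u).toAdd = k := by
      rw [← Int.mem_zmultiples_iff, ← he]
      rfl
    have h1 : e.natAbs ∣ hp i := hpgcd i _ fun m _ hm => by
      obtain ⟨l, rfl, hl⟩ := (pos_iff i m).1 hm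
      rw [← Int.dvd_natCast, hmem]
      refine ⟨_, hl, ?_⟩
      rw [FreeGroup.toAdd_totalExponent_prod_of]
    rw [← hmem]
    rw [hi] at h1
    exact Int.natAbs_dvd.1 (by exact_mod_cast h1)
  have : NeZero h := ⟨by omega⟩
  let ψ : FreeGroup (Fin n) →* Multiplicative (ZMod h) :=
    (Int.castAddHom (ZMod h)).toMultiplicative.comp (FreeGroup.totalExponent (Fin n))
  have hψ (g : FreeGroup (Fin n)) :
      (ψ g).toAdd = ((FreeGroup.totalExponent (Fin n) g).toAdd : ZMod h) := rfl
  have reach (u : FreeGroup (Fin n)) (hu : (FreeGroup.totalExponent (Fin n) u).toAdd = 1)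
      (z : Multiplicative (ZMod h)) : ψ (u ^ z.toAdd.val) = z := by
    apply Multiplicative.toAdd.injective
    rw [map_pow, toAdd_pow, hψ, hu]
    simp
  have main := card_le_and_index_eq_of_coset_partition H α hpart ψ
    (fun z => ⟨_, reach (FreeGroup.of a) (by simp [FreeGroup.totalExponent]) z⟩)
    (Finset.univ.filter fun i => hp i = h)
    (by obtain ⟨i, hi⟩ := hex; exact ⟨i, by simpa using hi⟩)
    (fun i hi g hg => by
      apply Multiplicative.toAdd.injective
      rw [hψ, toAdd_one, ZMod.intCast_zmod_eq_zero_iff_dvd]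
      simp only [Finset.mem_filter, Finset.mem_univ, true_and] at hi
      exact hi ▸ hdvd i g hg)
    (fun i hi z => by
      have h1 : hp i = 1 := by
        by_contra hne
        have := hp_pos i
        exact hi (by simpa using honly i (by omega))
      obtain ⟨u, hu, hu1⟩ := hone i h1
      exact ⟨_, pow_mem hu _, reach u hu1 z⟩)
  simp only [hidx, ← hr, Finset.mem_filter, Finset.mem_univ, true_and] at main
  have hcard : Nat.card (Multiplicative (ZMod h)) = h := Nat.card_zmod h
  rw [hcard] at main
  exact ⟨main.1, fun hrh i j hi hj => main.2 hrh i hi j hj⟩
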